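/- arXiv:1901.10640 — 2 statements merged into one kernel-verified Lean document; each statement's English description precedes it below -/
import Mathlib

section
/- Let E be a finite-dimensional spectral COSEA and a∈S_1(E) with unique state â satisfying â(a)=1. Then: (i) â is the unique state ω on E such that a∘b=ω(b)·a for all b∈E; (ii) â is the unique state ω on E such that ω(b)=ω(a∘b) for all b∈E; (iii) if ω∈Ω(E) with ω(a)≠0, then ω(a∘b)/ω(a)=â(b) for all b∈E. -/
set_option linter.unusedVariables false

universe u v

theorem prod_eq' {α β : Type*} {p q : α × β} (h1 : p.1 = q.1) (h2 : p.2 = q.2) : p = q :=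
  Prod.ext_iff.mpr ⟨h1, h2⟩

/-- A convex sequential effect algebra (COSEA).  The partial sum `⊕` is modelled by a
total operation `oplus` together with a definedness predicate `perp`; all axioms only
constrain `oplus` on pairs satisfying `perp`.  The scalar action is modelled by a total
map `smul : ℝ → E → E`, with axioms imposed for scalars in `[0,1]`. -/
structure COSEA (E : Type u) where
  zero : E
  one : E
  perp : E → E → Prop
  oplus : E → E → E
  compl : E → E
  smul : ℝ → E → E
  seq : E → E → E
  -- effect algebra axioms
  perp_comm : ∀ a b, perp a b → perp b a
  oplus_comm : ∀ a b, perp a b → oplus a b = oplus b a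
  perp_assoc_right : ∀ a b c, perp a b → perp (oplus a b) c → perp b c
  perp_assoc_left : ∀ a b c, perp a b → perp (oplus a b) c → perp a (oplus b c)
  oplus_assoc : ∀ a b c, perp a b → perp (oplus a b) c →
    oplus a (oplus b c) = oplus (oplus a b) c
  perp_compl : ∀ a, perp a (compl a)
  oplus_compl : ∀ a, oplus a (compl a) = one
  compl_unique : ∀ a b, perp a b → oplus a b = one → b = compl a
  perp_one : ∀ a, perp a one → a = zero
  -- convexity axioms
  smul_smul : ∀ α β a, 0 ≤ α → α ≤ 1 → 0 ≤ β → β ≤ 1 →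
    smul α (smul β a) = smul (α * β) a
  perp_smul_self : ∀ α β a, 0 ≤ α → 0 ≤ β → α + β ≤ 1 → perp (smul α a) (smul β a)
  add_smul : ∀ α β a, 0 ≤ α → 0 ≤ β → α + β ≤ 1 →
    smul (α + β) a = oplus (smul α a) (smul β a)
  perp_smul : ∀ lam a b, 0 ≤ lam → lam ≤ 1 → perp a b → perp (smul lam a) (smul lam b)
  smul_oplus : ∀ lam a b, 0 ≤ lam → lam ≤ 1 → perp a b →
    smul lam (oplus a b) = oplus (smul lam a) (smul lam b)
  one_smul : ∀ a, smul 1 a = a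
  -- sequential product axioms
  seq_perp : ∀ a b c, perp b c → perp (seq a b) (seq a c)
  seq_oplus : ∀ a b c, perp b c → seq a (oplus b c) = oplus (seq a b) (seq a c)
  one_seq : ∀ a, seq one a = a
  seq_eq_zero_comm : ∀ a b, seq a b = zero → seq b a = seq a b
  comm_compl : ∀ a b, seq a b = seq b a → seq a (compl b) = seq (compl b) a
  comm_assoc : ∀ a b c, seq a b = seq b a → seq a (seq b c) = seq (seq a b) c
  comm_seq : ∀ a b c, seq c a = seq a c → seq c b = seq b c →
    seq c (seq a b) = seq (seq a b) c
  comm_oplus : ∀ a b c, seq c a = seq a c → seq c b = seq b c → perp a b →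
    seq c (oplus a b) = seq (oplus a b) c
  smul_seq : ∀ lam a b, 0 ≤ lam → lam ≤ 1 → seq (smul lam a) b = smul lam (seq a b)
  seq_smul : ∀ lam a b, 0 ≤ lam → lam ≤ 1 → seq a (smul lam b) = smul lam (seq a b)

/-- `SumList C l s` : the orthogonal sum of the list `l` is defined and equals `s`. -/
inductive COSEA.SumList {E : Type u} (C : COSEA E) : List E → E → Prop
  | nil : COSEA.SumList C [] C.zero
  | cons {a : E} {l : List E} {s : E} :
      COSEA.SumList C l s → C.perp a s → COSEA.SumList C (a :: l) (C.oplus a s)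

namespace COSEA

variable {E : Type u}

/-- `a ≤ b` in the effect-algebra order. -/
def le (C : COSEA E) (a b : E) : Prop := ∃ c, C.perp a c ∧ C.oplus a c = b

/-- `a` is sharp: the greatest lower bound of `a` and `a'` is `0`,
i.e. every common lower bound of `a` and `a'` lies below `0`. -/
def IsSharp (C : COSEA E) (a : E) : Prop :=
  ∀ c, C.le c a → C.le c (C.compl a) → C.le c C.zero

/-- `a` is a one-dimensional (atomic) sharp element. -/
def IsOneDim (C : COSEA E) (a : E) : Prop :=
  C.IsSharp a ∧ a ≠ C.zero ∧
    ∀ b, C.le b a → ∃ lam : ℝ, 0 ≤ lam ∧ lam ≤ 1 ∧ b = C.smul lam a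

/-- A state on a COSEA. -/
def IsState (C : COSEA E) (ω : E → ℝ) : Prop :=
  (∀ a, 0 ≤ ω a ∧ ω a ≤ 1) ∧ ω C.one = 1 ∧
    ∀ a b, C.perp a b → ω (C.oplus a b) = ω a + ω b

/-- A context presented as an injective finite enumeration of one-dimensional
elements summing to `1`. -/
def IsContextFun (C : COSEA E) {n : ℕ} (a : Fin n → E) : Prop :=
  Function.Injective a ∧ (∀ i, C.IsOneDim (a i)) ∧ C.SumList (List.ofFn a) C.one

/-- A context as a set of effects. -/
def IsContext (C : COSEA E) (A : Set E) : Prop :=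
  ∃ (n : ℕ) (a : Fin n → E), C.IsContextFun a ∧ Set.range a = A

/-- `E` is finite-dimensional: there is no infinite sequence of one-dimensional
elements all of whose initial partial orthogonal sums are defined. -/
def FinDim (C : COSEA E) : Prop :=
  ¬ ∃ f : ℕ → E, (∀ i, C.IsOneDim (f i)) ∧
      ∀ n : ℕ, ∃ s, C.SumList ((List.range n).map f) s

/-- `E` is state-unique. -/
def StateUnique (C : COSEA E) : Prop :=
  ∀ a, C.IsOneDim a → ∃! ω : E → ℝ, C.IsState ω ∧ ω a = 1

/-- `E` is symmetric : `â(b) = b̂(a)` for all one-dimensional `a, b`. -/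
def Symm (C : COSEA E) : Prop :=
  ∀ a b ω ρ, C.IsOneDim a → C.IsOneDim b → C.IsState ω → C.IsState ρ →
    ω a = 1 → ρ b = 1 → ω b = ρ a

/-- `b = λ₁ a₁ ⊕ ⋯ ⊕ λₙ aₙ` with all `λ i ∈ [0,1]`. -/
def SpanRep (C : COSEA E) {n : ℕ} (a : Fin n → E) (lam : Fin n → ℝ) (b : E) : Prop :=
  (∀ i, 0 ≤ lam i ∧ lam i ≤ 1) ∧
    C.SumList (List.ofFn fun i => C.smul (lam i) (a i)) b

/-- `b ∈ E(A)` : `b` has a representation over the context `A`. -/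
def InSpan (C : COSEA E) (A : Set E) (b : E) : Prop :=
  ∃ (n : ℕ) (a : Fin n → E) (lam : Fin n → ℝ),
    C.IsContextFun a ∧ Set.range a = A ∧ C.SpanRep a lam b

/-- `E` is spectral. -/
def Spectral (C : COSEA E) : Prop :=
  C.StateUnique ∧ ∀ b, ∃ A, C.IsContext A ∧ C.InSpan A b

/-- The commutant of a subset. -/
def commutant (C : COSEA E) (F : Set E) : Set E :=
  {b | ∀ a ∈ F, C.seq b a = C.seq a b}

/-- The center `E' = {b : b ∘ a = a ∘ b for all a}`. -/
def center (C : COSEA E) : Set E := C.commutant Set.univ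

/-- `E` is a factor: the center consists of the effects `λ 1`, `λ ∈ [0,1]`. -/
def IsFactor (C : COSEA E) : Prop :=
  C.center = {b | ∃ lam : ℝ, 0 ≤ lam ∧ lam ≤ 1 ∧ b = C.smul lam C.one}

/-- Sub-COSEA. -/
def IsSubCOSEA (C : COSEA E) (F : Set E) : Prop :=
  C.zero ∈ F ∧ C.one ∈ F ∧ (∀ a ∈ F, C.compl a ∈ F) ∧
    (∀ lam : ℝ, 0 ≤ lam → lam ≤ 1 → ∀ a ∈ F, C.smul lam a ∈ F) ∧
    (∀ a ∈ F, ∀ b ∈ F, C.perp a b → C.oplus a b ∈ F) ∧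
    (∀ a ∈ F, ∀ b ∈ F, C.seq a b ∈ F)

/-- `a` is a minimal sharp element of `F`. -/
def MinSharp (C : COSEA E) (F : Set E) (a : E) : Prop :=
  a ∈ F ∧ C.IsSharp a ∧ a ≠ C.zero ∧
    ∀ b ∈ F, C.IsSharp b → b ≠ C.zero → C.le b a → b = a

/-- COSEA isomorphism. -/
def IsIso {F : Type u} (C : COSEA E) (D : COSEA F) (φ : E → F) : Prop :=
  Function.Bijective φ ∧ φ C.one = D.one ∧
    (∀ a b, C.perp a b ↔ D.perp (φ a) (φ b)) ∧
    (∀ a b, C.perp a b → φ (C.oplus a b) = D.oplus (φ a) (φ b)) ∧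
    (∀ lam : ℝ, 0 ≤ lam → lam ≤ 1 → ∀ a, φ (C.smul lam a) = D.smul lam (φ a)) ∧
    (∀ a b, φ (C.seq a b) = D.seq (φ a) (φ b))

/-- `lam` is an eigenvalue of `b` : `lam = â(b)` for some eigeneffect `a` of `b`. -/
def IsEigenvalue (C : COSEA E) (b : E) (lam : ℝ) : Prop :=
  ∃ (a : E) (ω : E → ℝ), C.IsOneDim a ∧ C.seq a b = C.seq b a ∧
    C.IsState ω ∧ ω a = 1 ∧ lam = ω b

/-- The spectrum of `b`. -/
def spectrum (C : COSEA E) (b : E) : Set ℝ := {lam | C.IsEigenvalue b lam}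

/-- `c = ⌈a⌉` : `c` is the least sharp element dominating `a`. -/
def IsCeil (C : COSEA E) (a c : E) : Prop :=
  C.IsSharp c ∧ C.le a c ∧ ∀ d, C.IsSharp d → C.le a d → C.le c d

/-- `b` is a pseudo-inverse of `a` with scalar `lam` :
`⌈b⌉ = ⌈a⌉`, `‖b‖ = 1` and `a ∘ b = b ∘ a = lam ⌈a⌉`. -/
def IsPseudoInvWith (C : COSEA E) (a b : E) (lam : ℝ) : Prop :=
  (∃ ca, C.IsCeil a ca ∧ C.IsCeil b ca ∧
    C.seq a b = C.smul lam ca ∧ C.seq b a = C.smul lam ca) ∧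
  IsGreatest (C.spectrum b) 1 ∧ 0 ≤ lam ∧ lam ≤ 1

/-- The conditional probability map `γ_a` (zero functionals are sent to `0`). -/
noncomputable def condProb (C : COSEA E) (a : E) (ω : E → ℝ) : E → ℝ :=
  fun c => if ω a = 0 then 0 else ω (C.seq a c) / ω a

/-- Membership in `Ω̂(E) = Ω(E) ∪ {0}`. -/
def InOmegaHat (C : COSEA E) (ω : E → ℝ) : Prop :=
  C.IsState ω ∨ ω = fun _ => 0

/-- Direct sum of two COSEAs, with all operations componentwise. -/
def prod {E F : Type u} (C : COSEA E) (D : COSEA F) : COSEA (E × F) where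
  zero := (C.zero, D.zero)
  one := (C.one, D.one)
  perp a b := C.perp a.1 b.1 ∧ D.perp a.2 b.2
  oplus a b := (C.oplus a.1 b.1, D.oplus a.2 b.2)
  compl a := (C.compl a.1, D.compl a.2)
  smul lam a := (C.smul lam a.1, D.smul lam a.2)
  seq a b := (C.seq a.1 b.1, D.seq a.2 b.2)
  perp_comm := fun a b h => ⟨C.perp_comm _ _ h.1, D.perp_comm _ _ h.2⟩
  oplus_comm := fun a b h => prod_eq' (C.oplus_comm _ _ h.1) (D.oplus_comm _ _ h.2)
  perp_assoc_right := fun a b c h1 h2 =>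
    ⟨C.perp_assoc_right _ _ _ h1.1 h2.1, D.perp_assoc_right _ _ _ h1.2 h2.2⟩
  perp_assoc_left := fun a b c h1 h2 =>
    ⟨C.perp_assoc_left _ _ _ h1.1 h2.1, D.perp_assoc_left _ _ _ h1.2 h2.2⟩
  oplus_assoc := fun a b c h1 h2 =>
    prod_eq' (C.oplus_assoc _ _ _ h1.1 h2.1) (D.oplus_assoc _ _ _ h1.2 h2.2)
  perp_compl := fun a => ⟨C.perp_compl _, D.perp_compl _⟩
  oplus_compl := fun a => prod_eq' (C.oplus_compl _) (D.oplus_compl _)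
  compl_unique := fun a b h he =>
    prod_eq' (C.compl_unique _ _ h.1 (congrArg Prod.fst he))
      (D.compl_unique _ _ h.2 (congrArg Prod.snd he))
  perp_one := fun a h => prod_eq' (C.perp_one _ h.1) (D.perp_one _ h.2)
  smul_smul := fun α β a h1 h2 h3 h4 =>
    prod_eq' (C.smul_smul _ _ _ h1 h2 h3 h4) (D.smul_smul _ _ _ h1 h2 h3 h4)
  perp_smul_self := fun α β a h1 h2 h3 =>
    ⟨C.perp_smul_self _ _ _ h1 h2 h3, D.perp_smul_self _ _ _ h1 h2 h3⟩
  add_smul := fun α β a h1 h2 h3 =>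
    prod_eq' (C.add_smul _ _ _ h1 h2 h3) (D.add_smul _ _ _ h1 h2 h3)
  perp_smul := fun lam a b h1 h2 h =>
    ⟨C.perp_smul _ _ _ h1 h2 h.1, D.perp_smul _ _ _ h1 h2 h.2⟩
  smul_oplus := fun lam a b h1 h2 h =>
    prod_eq' (C.smul_oplus _ _ _ h1 h2 h.1) (D.smul_oplus _ _ _ h1 h2 h.2)
  one_smul := fun a => prod_eq' (C.one_smul _) (D.one_smul _)
  seq_perp := fun a b c h => ⟨C.seq_perp _ _ _ h.1, D.seq_perp _ _ _ h.2⟩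
  seq_oplus := fun a b c h => prod_eq' (C.seq_oplus _ _ _ h.1) (D.seq_oplus _ _ _ h.2)
  one_seq := fun a => prod_eq' (C.one_seq _) (D.one_seq _)
  seq_eq_zero_comm := fun a b h =>
    prod_eq' (C.seq_eq_zero_comm _ _ (congrArg Prod.fst h))
      (D.seq_eq_zero_comm _ _ (congrArg Prod.snd h))
  comm_compl := fun a b h =>
    prod_eq' (C.comm_compl _ _ (congrArg Prod.fst h))
      (D.comm_compl _ _ (congrArg Prod.snd h))
  comm_assoc := fun a b c h =>
    prod_eq' (C.comm_assoc _ _ _ (congrArg Prod.fst h))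
      (D.comm_assoc _ _ _ (congrArg Prod.snd h))
  comm_seq := fun a b c h1 h2 =>
    prod_eq' (C.comm_seq _ _ _ (congrArg Prod.fst h1) (congrArg Prod.fst h2))
      (D.comm_seq _ _ _ (congrArg Prod.snd h1) (congrArg Prod.snd h2))
  comm_oplus := fun a b c h1 h2 hp =>
    prod_eq' (C.comm_oplus _ _ _ (congrArg Prod.fst h1) (congrArg Prod.fst h2) hp.1)
      (D.comm_oplus _ _ _ (congrArg Prod.snd h1) (congrArg Prod.snd h2) hp.2)
  smul_seq := fun lam a b h1 h2 =>
    prod_eq' (C.smul_seq _ _ _ h1 h2) (D.smul_seq _ _ _ h1 h2)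
  seq_smul := fun lam a b h1 h2 =>
    prod_eq' (C.seq_smul _ _ _ h1 h2) (D.seq_smul _ _ _ h1 h2)

/-- Direct sum of a family of COSEAs, with all operations componentwise. -/
def pi {ι : Type v} {E : ι → Type u} (C : ∀ i, COSEA (E i)) : COSEA (∀ i, E i) where
  zero := fun i => (C i).zero
  one := fun i => (C i).one
  perp a b := ∀ i, (C i).perp (a i) (b i)
  oplus a b := fun i => (C i).oplus (a i) (b i)
  compl a := fun i => (C i).compl (a i)
  smul lam a := fun i => (C i).smul lam (a i)
  seq a b := fun i => (C i).seq (a i) (b i)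
  perp_comm := fun a b h i => (C i).perp_comm _ _ (h i)
  oplus_comm := fun a b h => funext fun i => (C i).oplus_comm _ _ (h i)
  perp_assoc_right := fun a b c h1 h2 i => (C i).perp_assoc_right _ _ _ (h1 i) (h2 i)
  perp_assoc_left := fun a b c h1 h2 i => (C i).perp_assoc_left _ _ _ (h1 i) (h2 i)
  oplus_assoc := fun a b c h1 h2 => funext fun i => (C i).oplus_assoc _ _ _ (h1 i) (h2 i)
  perp_compl := fun a i => (C i).perp_compl _
  oplus_compl := fun a => funext fun i => (C i).oplus_compl _
  compl_unique := fun a b h he =>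
    funext fun i => (C i).compl_unique _ _ (h i) (congrFun he i)
  perp_one := fun a h => funext fun i => (C i).perp_one _ (h i)
  smul_smul := fun α β a h1 h2 h3 h4 =>
    funext fun i => (C i).smul_smul _ _ _ h1 h2 h3 h4
  perp_smul_self := fun α β a h1 h2 h3 i => (C i).perp_smul_self _ _ _ h1 h2 h3
  add_smul := fun α β a h1 h2 h3 => funext fun i => (C i).add_smul _ _ _ h1 h2 h3
  perp_smul := fun lam a b h1 h2 h i => (C i).perp_smul _ _ _ h1 h2 (h i)
  smul_oplus := fun lam a b h1 h2 h =>
    funext fun i => (C i).smul_oplus _ _ _ h1 h2 (h i)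
  one_smul := fun a => funext fun i => (C i).one_smul _
  seq_perp := fun a b c h i => (C i).seq_perp _ _ _ (h i)
  seq_oplus := fun a b c h => funext fun i => (C i).seq_oplus _ _ _ (h i)
  one_seq := fun a => funext fun i => (C i).one_seq _
  seq_eq_zero_comm := fun a b h =>
    funext fun i => (C i).seq_eq_zero_comm _ _ (congrFun h i)
  comm_compl := fun a b h => funext fun i => (C i).comm_compl _ _ (congrFun h i)
  comm_assoc := fun a b c h => funext fun i => (C i).comm_assoc _ _ _ (congrFun h i)
  comm_seq := fun a b c h1 h2 =>
    funext fun i => (C i).comm_seq _ _ _ (congrFun h1 i) (congrFun h2 i)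
  comm_oplus := fun a b c h1 h2 hp =>
    funext fun i => (C i).comm_oplus _ _ _ (congrFun h1 i) (congrFun h2 i) (hp i)
  smul_seq := fun lam a b h1 h2 => funext fun i => (C i).smul_seq _ _ _ h1 h2
  seq_smul := fun lam a b h1 h2 => funext fun i => (C i).seq_smul _ _ _ h1 h2

end COSEA

namespace COSEA

theorem compl_one {E : Type u} (C : COSEA E) : C.compl C.one = C.zero :=
  C.perp_one _ (C.perp_comm _ _ (C.perp_compl C.one))

theorem one_eq_compl_zero {E : Type u} (C : COSEA E) : C.one = C.compl C.zero := by
  have h := C.perp_compl C.one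
  have h' := C.oplus_compl C.one
  rw [C.compl_one] at h h'
  exact C.compl_unique _ _ (C.perp_comm _ _ h) ((C.oplus_comm _ _ h).symm.trans h')

theorem oplus_zero {E : Type u} (C : COSEA E) (a : E) : C.perp a C.zero ∧ C.oplus a C.zero = a := by
  have hp := C.perp_comm _ _ (C.perp_compl a)
  have hs : C.oplus (C.compl a) a = C.one :=
    (C.oplus_comm _ _ hp).trans (C.oplus_compl a)
  have h1 : C.perp (C.oplus (C.compl a) a) C.zero := by
    rw [hs, ← C.compl_one]
    exact C.perp_compl _
  have h2 : C.oplus (C.oplus (C.compl a) a) C.zero = C.one := by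
    rw [hs, ← C.compl_one]
    exact C.oplus_compl _
  refine ⟨C.perp_assoc_right _ _ _ hp h1, ?_⟩
  rw [C.compl_unique _ _ (C.perp_assoc_left _ _ _ hp h1)
    ((C.oplus_assoc _ _ _ hp h1).trans h2)]
  exact (C.compl_unique _ _ hp hs).symm

theorem eq_zero_of_le_zero {E : Type u} (C : COSEA E) {c : E} (h : C.le c C.zero) : c = C.zero := by
  obtain ⟨d, hp, hd⟩ := h
  apply C.perp_one
  refine C.perp_assoc_right _ _ _ (C.perp_comm _ _ hp) ?_
  rw [← C.oplus_comm _ _ hp, hd]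
  exact C.perp_comm _ _ (C.oplus_zero _).1

theorem eq_zero_of_oplus_self {E : Type u} (C : COSEA E) {x : E} (hp : C.perp x x)
    (h : C.oplus x x = x) : x = C.zero := by
  apply C.perp_one
  rw [← C.oplus_compl x]
  refine C.perp_assoc_left _ _ _ hp ?_
  rw [h]
  exact C.perp_compl x

theorem seq_zero {E : Type u} (C : COSEA E) (a : E) : C.seq a C.zero = C.zero := by
  obtain ⟨hp, h⟩ := C.oplus_zero C.zero
  refine C.eq_zero_of_oplus_self (C.seq_perp _ _ _ hp) ?_
  rw [← C.seq_oplus _ _ _ hp, h]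

theorem seq_one {E : Type u} (C : COSEA E) (a : E) : C.seq a C.one = a := by
  have h := C.comm_compl a C.zero (C.seq_eq_zero_comm _ _ (C.seq_zero a)).symm
  rw [← C.one_eq_compl_zero] at h
  rw [h, C.one_seq]

theorem seq_oplus_seq_compl {E : Type u} (C : COSEA E) (a b : E) :
    C.oplus (C.seq a b) (C.seq a (C.compl b)) = a := by
  rw [← C.seq_oplus _ _ _ (C.perp_compl b), C.oplus_compl, C.seq_one]

theorem seq_le {E : Type u} (C : COSEA E) (a b : E) : C.le (C.seq a b) a :=
  ⟨_, C.seq_perp _ _ _ (C.perp_compl b), C.seq_oplus_seq_compl a b⟩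

theorem IsSharp.seq_self {E : Type u} {C : COSEA E} {a : E} (ha : C.IsSharp a) : C.seq a a = a := by
  have h0 : C.seq a (C.compl a) = C.zero := by
    refine C.eq_zero_of_le_zero (ha _ (C.seq_le _ _) ?_)
    rw [C.comm_compl a a rfl]
    exact C.seq_le _ _
  have h := C.seq_oplus_seq_compl a a
  rwa [h0, (C.oplus_zero _).2] at h

end COSEA

/-- A nonnegative additive function on `[0,1]` is linear. -/
theorem eq_mul_of_additive_of_nonneg {f : ℝ → ℝ}
    (hadd : ∀ s t, 0 ≤ s → 0 ≤ t → s + t ≤ 1 → f (s + t) = f s + f t)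
    (hnonneg : ∀ t, 0 ≤ t → t ≤ 1 → 0 ≤ f t) {t : ℝ} (ht0 : 0 ≤ t) (ht1 : t ≤ 1) :
    f t = t * f 1 := by
  have f_zero : f 0 = 0 := by
    have := hadd 0 0 le_rfl le_rfl (by norm_num)
    rw [add_zero] at this
    linarith
  have f_nsmul : ∀ (x : ℝ), 0 ≤ x → ∀ k : ℕ, k * x ≤ 1 → f (k * x) = k * f x := by
    intro x hx k
    induction k with
    | zero => intro _; simp [f_zero]
    | succ k ih =>
      intro hk
      push_cast at hk ⊢
      have hkx : (k : ℝ) * x + x ≤ 1 := by linarith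
      rw [add_mul, one_mul, hadd _ _ (by positivity) hx hkx, ih (by linarith)]
      ring
  have lower : ∀ (n : ℕ), 0 < n → ∀ s, 0 ≤ s → s ≤ 1 → s * f 1 - f 1 / n ≤ f s := by
    intro n hn s hs0 hs1
    have hn' : (0 : ℝ) < n := by exact_mod_cast hn
    have h1 := f_nsmul (1 / n) (by positivity) n (by field_simp; exact le_rfl)
    rw [mul_one_div_cancel hn'.ne'] at h1
    have hfl := Nat.floor_le (mul_nonneg hn'.le hs0)
    have hlt := Nat.lt_floor_add_one (n * s)
    set k := ⌊n * s⌋₊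
    have hks : (k : ℝ) * (1 / n) ≤ s := by
      rw [mul_one_div, div_le_iff₀ hn']
      linarith
    have h2 := f_nsmul (1 / n) (by positivity) k (hks.trans hs1)
    have h3 := hadd (k * (1 / n)) (s - k * (1 / n)) (by positivity) (by linarith) (by linarith)
    rw [add_sub_cancel] at h3
    have h4 := hnonneg (s - k * (1 / n)) (by linarith)
      (by linarith [show (0 : ℝ) ≤ k * (1 / n) by positivity])
    have h5 : f (1 / n) = f 1 / n := by rw [h1]; field_simp
    rw [h3, h2, h5]
    have h6 : 0 ≤ f 1 / n := div_nonneg (hnonneg 1 zero_le_one le_rfl) hn'.le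
    have h7 : s * f 1 = n * s * (f 1 / n) := by field_simp
    rw [h7]
    nlinarith
  have f_compl : f 1 = f t + f (1 - t) := by
    simpa using hadd t (1 - t) ht0 (by linarith) (by linarith)
  have bound : ∀ n : ℕ, 0 < n → |f t - t * f 1| ≤ f 1 / n := by
    intro n hn
    rw [abs_le]
    constructor
    · linarith [lower n hn t ht0 ht1]
    · linarith [lower n hn (1 - t) (by linarith) (by linarith)]
  have hlim : Filter.Tendsto (fun n : ℕ => f 1 / n) Filter.atTop (nhds 0) :=
    tendsto_const_div_atTop_nhds_zero_nat _
  have habs : |f t - t * f 1| ≤ 0 :=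
    ge_of_tendsto hlim ((Filter.eventually_gt_atTop 0).mono bound)
  linarith [abs_eq_zero.mp (le_antisymm habs (abs_nonneg _))]

namespace COSEA

theorem IsState.map_smul {E : Type u} {C : COSEA E} {ω : E → ℝ} (hω : C.IsState ω) {t : ℝ}
    (ht0 : 0 ≤ t) (ht1 : t ≤ 1) (a : E) : ω (C.smul t a) = t * ω a := by
  have h := eq_mul_of_additive_of_nonneg (f := fun s => ω (C.smul s a))
    (fun s r hs hr hsr => by
      simp only [C.add_smul s r a hs hr hsr]
      exact hω.2.2 _ _ (C.perp_smul_self s r a hs hr hsr))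
    (fun s _ _ => (hω.1 _).1) ht0 ht1
  simpa only [C.one_smul] using h

/-- Conditioning a state on an effect of probability one gives a state. -/
theorem IsState.comp_seq {E : Type u} {C : COSEA E} {ω : E → ℝ} (hω : C.IsState ω) {a : E}
    (ha : ω a = 1) : C.IsState fun b => ω (C.seq a b) := by
  refine ⟨fun b => hω.1 _, ?_, fun b c h => ?_⟩
  · simpa only [C.seq_one] using ha
  · simp only [C.seq_oplus _ _ _ h]
    exact hω.2.2 _ _ (C.seq_perp _ _ _ h)

end COSEA

/-- characterizations of the state `â` associated with a
one-dimensional effect `a`. -/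
theorem hat_state_characterizations {E : Type u} (C : COSEA E)
    (hFD : C.FinDim) (hSp : C.Spectral) (a : E) (ha : C.IsOneDim a)
    (ω₀ : E → ℝ) (h₀ : C.IsState ω₀) (h₀a : ω₀ a = 1) :
    -- (i)
    ((∀ b, C.seq a b = C.smul (ω₀ b) a) ∧
      ∀ ω, C.IsState ω → (∀ b, C.seq a b = C.smul (ω b) a) → ω = ω₀) ∧
    -- (ii)
    ((∀ b, ω₀ b = ω₀ (C.seq a b)) ∧
      ∀ ω, C.IsState ω → (∀ b, ω b = ω (C.seq a b)) → ω = ω₀) ∧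
    -- (iii)
    (∀ ω, C.IsState ω → ω a ≠ 0 → ∀ b, ω (C.seq a b) / ω a = ω₀ b) := by
  have huniq : ∀ ω, C.IsState ω → ω a = 1 → ω = ω₀ := fun ω hω hωa =>
    (hSp.1 a ha).unique ⟨hω, hωa⟩ ⟨h₀, h₀a⟩
  have haa : C.seq a a = a := ha.1.seq_self
  have hcond : ∀ b, ω₀ (C.seq a b) = ω₀ b :=
    congrFun (huniq _ (h₀.comp_seq h₀a) (by simpa only [haa] using h₀a))
  have hseq : ∀ b, C.seq a b = C.smul (ω₀ b) a := by
    intro b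
    obtain ⟨t, ht0, ht1, ht⟩ := ha.2.2 _ (C.seq_le a b)
    have h := hcond b
    rw [ht, h₀.map_smul ht0 ht1, h₀a, mul_one] at h
    rw [ht, h]
  refine ⟨⟨hseq, fun ω hω h => huniq ω hω ?_⟩,
    ⟨fun b => (hcond b).symm, fun ω hω h => huniq ω hω ?_⟩, fun ω hω hne b => ?_⟩
  · have h' := congrArg ω₀ (h a)
    rw [haa, h₀.map_smul (hω.1 a).1 (hω.1 a).2, h₀a, mul_one] at h'
    exact h'.symm
  · rw [← hω.2.1, h C.one, C.seq_one]
  · rw [hseq, hω.map_smul (h₀.1 b).1 (h₀.1 b).2, mul_div_assoc, div_self hne, mul_one]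
end

section
/- Let E be a finite-dimensional spectral COSEA and a∈E. There exists a unique state ω∈Ω(E) with ω(a)=1 if and only if there exists a context {a_1,…,a_n} and λ_2,…,λ_n∈[0,1) such that a=a_1⊕λ_2a_2⊕⋯⊕λ_na_n. -/
set_option linter.unusedVariables false

universe u v

namespace COSEA

variable {E : Type u} {C : COSEA E}

theorem SumList.perm {l l' : List E} (h : l.Perm l') :
    ∀ {s : E}, C.SumList l s → C.SumList l' s := by
  induction h with
  | nil => exact id
  | cons x _ ih =>
    intro s hs
    cases hs with
    | cons hl hp => exact .cons (ih hl) hp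
  | swap x y l =>
    intro s hs
    cases hs with
    | cons hl hp =>
      cases hl with
      | @cons _ _ t hl hq =>
        have hq' := C.perp_comm _ _ hq
        have hp' := C.perp_comm _ _ hp
        have hxt := C.perp_comm _ _ (C.perp_assoc_right _ _ _ hq hp')
        have hty := C.perp_assoc_right _ _ _ hq hp'
        have hx := C.perp_assoc_left _ _ _ hq hp'
        have he := C.oplus_assoc _ _ _ hq hp'
        rw [C.oplus_comm _ _ hty] at hx he
        rw [C.oplus_comm _ _ hp, ← he]
        exact .cons (.cons hl hxt) hx
  | trans _ _ ih₁ ih₂ => exact fun hs => ih₂ (ih₁ hs)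

namespace IsState

variable {ω : E → ℝ}

theorem map_zero (h : C.IsState ω) : ω C.zero = 0 := by
  have hz : C.compl C.one = C.zero :=
    C.perp_one _ (C.perp_comm _ _ (C.perp_compl C.one))
  have key := h.2.2 _ _ (C.perp_compl C.one)
  rw [C.oplus_compl, hz] at key
  linarith

theorem map_sumList (h : C.IsState ω) {l : List E} {s : E} (hs : C.SumList l s) :
    ω s = (l.map ω).sum := by
  induction hs with
  | nil => simpa using h.map_zero
  | cons _ hp ih => rw [h.2.2 _ _ hp, ih, List.map_cons, List.sum_cons]

theorem map_add_smul (h : C.IsState ω) {α β : ℝ} (hα : 0 ≤ α) (hβ : 0 ≤ β)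
    (hαβ : α + β ≤ 1) (a : E) :
    ω (C.smul (α + β) a) = ω (C.smul α a) + ω (C.smul β a) := by
  rw [C.add_smul _ _ _ hα hβ hαβ, h.2.2 _ _ (C.perp_smul_self _ _ _ hα hβ hαβ)]

theorem map_natCast_mul_smul (h : C.IsState ω) {x : ℝ} (hx : 0 ≤ x) (a : E) (k : ℕ)
    (hk : k * x ≤ 1) : ω (C.smul (k * x) a) = k * ω (C.smul x a) := by
  induction k with
  | zero =>
    have := h.map_add_smul (le_refl (0 : ℝ)) le_rfl (by norm_num) a
    rw [add_zero] at this
    simp only [Nat.cast_zero, zero_mul]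
    linarith
  | succ k ih =>
    push_cast at hk ⊢
    have hk' : k * x + x ≤ 1 := by linarith
    rw [add_mul, one_mul, h.map_add_smul (by positivity) hx hk', ih (by linarith)]
    ring

theorem mul_le_map_smul (h : C.IsState ω) {lam : ℝ} (h0 : 0 ≤ lam) (h1 : lam ≤ 1) (a : E) :
    lam * ω a ≤ ω (C.smul lam a) := by
  have hG := h.1 a
  refine le_of_forall_pos_le_add fun ε hε => ?_
  obtain ⟨n, hn⟩ := exists_nat_one_div_lt hε
  set N : ℝ := (n : ℝ) + 1 with hN
  have hNpos : 0 < N := by positivity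
  have hunit : ω a = N * ω (C.smul (1 / N) a) := by
    have := h.map_natCast_mul_smul (x := 1 / N) (by positivity) a (n + 1)
      (by push_cast; rw [← hN]; field_simp; exact le_rfl)
    push_cast at this
    rwa [← hN, mul_one_div_cancel hNpos.ne', C.one_smul] at this
  set m := ⌊lam * N⌋₊
  have hm : (m : ℝ) ≤ lam * N := Nat.floor_le (by positivity)
  have hm' : lam * N < m + 1 := Nat.lt_floor_add_one _
  have hle : m * (1 / N) ≤ lam := by
    rw [mul_one_div, div_le_iff₀ hNpos]; exact hm
  have hlt : lam < m * (1 / N) + 1 / N := by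
    rw [← add_one_mul, mul_one_div, lt_div_iff₀ hNpos]; exact hm'
  have hmap := h.map_natCast_mul_smul (x := 1 / N) (by positivity) a m (hle.trans h1)
  have hsplit := h.map_add_smul (α := m * (1 / N)) (β := lam - m * (1 / N))
    (by positivity) (by linarith) (by linarith) a
  rw [add_sub_cancel] at hsplit
  have hnn := (h.1 (C.smul (lam - m * (1 / N)) a)).1
  have hval : m * ω (C.smul (1 / N) a) = m * (1 / N) * ω a := by
    rw [hunit]; field_simp
  nlinarith

theorem map_smul_s14 (h : C.IsState ω) {lam : ℝ} (h0 : 0 ≤ lam) (h1 : lam ≤ 1) (a : E) :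
    ω (C.smul lam a) = lam * ω a := by
  refine le_antisymm ?_ (h.mul_le_map_smul h0 h1 a)
  have hadd := h.map_add_smul h0 (sub_nonneg.2 h1) (by linarith) a
  rw [add_sub_cancel, C.one_smul] at hadd
  linarith [h.mul_le_map_smul (sub_nonneg.2 h1) (by linarith) a]

theorem sum_context (h : C.IsState ω) {n : ℕ} {f : Fin n → E} (hf : C.IsContextFun f) :
    ∑ i, ω (f i) = 1 := by
  rw [← h.2.1, h.map_sumList hf.2.2, List.map_ofFn, List.sum_ofFn]
  rfl

theorem map_spanRep (h : C.IsState ω) {n : ℕ} {f : Fin n → E} {lam : Fin n → ℝ} {a : E}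
    (ha : C.SpanRep f lam a) : ω a = ∑ i, lam i * ω (f i) := by
  rw [h.map_sumList ha.2, List.map_ofFn, List.sum_ofFn]
  exact Finset.sum_congr rfl fun i _ => h.map_smul_s14 (ha.1 i).1 (ha.1 i).2 (f i)

/-- A state giving `λ₁a₁ ⊕ ⋯ ⊕ λₙaₙ` the value `1` vanishes on every `aᵢ` with `λᵢ < 1`. -/
theorem map_eq_zero_of_lt_one (h : C.IsState ω) {n : ℕ} {f : Fin n → E} {lam : Fin n → ℝ}
    {a : E} (hf : C.IsContextFun f) (ha : C.SpanRep f lam a) (h1 : ω a = 1) {i : Fin n}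
    (hi : lam i < 1) : ω (f i) = 0 := by
  have hsum : ∑ j, (1 - lam j) * ω (f j) = 0 := by
    simp only [sub_mul, one_mul, Finset.sum_sub_distrib]
    rw [h.sum_context hf, ← h.map_spanRep ha, h1, sub_self]
  have hz := (Finset.sum_eq_zero_iff_of_nonneg fun j _ =>
    mul_nonneg (sub_nonneg.2 (ha.1 j).2) (h.1 (f j)).1).1 hsum i (Finset.mem_univ i)
  exact (mul_eq_zero.1 hz).resolve_left (sub_pos.2 hi).ne'

theorem eq_one_of_coeff_eq_one (h : C.IsState ω) {n : ℕ} {f : Fin n → E} {lam : Fin n → ℝ}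
    {a : E} (ha : C.SpanRep f lam a) {i : Fin n} (hi : lam i = 1)
    (h1 : ω (f i) = 1) : ω a = 1 := by
  refine le_antisymm (h.1 a).2 ?_
  have hle := Finset.single_le_sum (f := fun j => lam j * ω (f j))
    (fun j _ => mul_nonneg (ha.1 j).1 (h.1 (f j)).1) (Finset.mem_univ i)
  rw [h.map_spanRep ha]
  simpa [hi, h1] using hle

theorem index_unique (h : C.IsState ω) {n : ℕ} {f : Fin n → E} (hf : C.IsContextFun f)
    {i j : Fin n} (hi : ω (f i) = 1) (hj : ω (f j) = 1) : i = j := by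
  by_contra hij
  have hle := Finset.sum_le_sum_of_subset_of_nonneg (Finset.subset_univ {i, j})
    (f := fun k => ω (f k)) fun k _ _ => (h.1 (f k)).1
  rw [Finset.sum_pair hij, h.sum_context hf] at hle
  linarith

end IsState

theorem IsContextFun.comp_perm {n : ℕ} {f : Fin n → E} (hf : C.IsContextFun f)
    (σ : Equiv.Perm (Fin n)) : C.IsContextFun (f ∘ σ) :=
  ⟨hf.1.comp σ.injective, fun i => hf.2.1 (σ i),
    hf.2.2.perm (σ.ofFn_comp_perm f).symm⟩

theorem SpanRep.comp_perm {n : ℕ} {f : Fin n → E} {lam : Fin n → ℝ} {a : E}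
    (ha : C.SpanRep f lam a) (σ : Equiv.Perm (Fin n)) :
    C.SpanRep (f ∘ σ) (lam ∘ σ) a :=
  ⟨fun i => ha.1 (σ i), ha.2.perm (σ.ofFn_comp_perm fun i => C.smul (lam i) (f i)).symm⟩

end COSEA

/-- `a` has a unique state giving it probability 1 iff
`a = a₁ ⊕ λ₂a₂ ⊕ ⋯ ⊕ λₙaₙ` over a context with λ_i ∈ [0,1) for i ≥ 2. -/
theorem unique_state_one_iff {E : Type u} (C : COSEA E)
    (hFD : C.FinDim) (hSp : C.Spectral) (a : E) :
    (∃! ω : E → ℝ, C.IsState ω ∧ ω a = 1) ↔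
      ∃ (n : ℕ) (f : Fin (n + 1) → E) (lam : Fin (n + 1) → ℝ),
        C.IsContextFun f ∧ lam 0 = 1 ∧ (∀ i, 0 ≤ lam i) ∧
        (∀ i, i ≠ 0 → lam i < 1) ∧
        C.SumList (List.ofFn fun i => C.smul (lam i) (f i)) a := by
  constructor
  · rintro ⟨ω, ⟨hω, hωa⟩, huniq⟩
    obtain ⟨A, -, n, f, lam, hf, -, ha⟩ := hSp.2 a
    have state_eq {j : Fin n} (hj : lam j = 1) : ω (f j) = 1 := by
      obtain ⟨ρ, ⟨hρ, hρj⟩, -⟩ := hSp.1 (f j) (hf.2.1 j)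
      rw [← huniq ρ ⟨hρ, hρ.eq_one_of_coeff_eq_one ha hj hρj⟩, hρj]
    obtain ⟨i, hi⟩ : ∃ i, lam i = 1 := by
      by_contra! hne
      have hzero := hω.sum_context hf
      rw [Finset.sum_eq_zero fun i _ => hω.map_eq_zero_of_lt_one hf ha hωa
        (lt_of_le_of_ne (ha.1 i).2 (hne i))] at hzero
      exact zero_ne_one hzero
    obtain _ | n := n
    · exact i.elim0
    have ha' := ha.comp_perm (Equiv.swap 0 i)
    refine ⟨n, f ∘ Equiv.swap 0 i, lam ∘ Equiv.swap 0 i, hf.comp_perm _, by simpa using hi,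
      fun j => (ha'.1 j).1, fun j hj => lt_of_le_of_ne (ha'.1 j).2 fun hj1 => hj ?_, ha'.2⟩
    have hji := hω.index_unique hf (state_eq hj1) (state_eq hi)
    rwa [Equiv.swap_apply_eq_iff, Equiv.swap_apply_right] at hji
  · rintro ⟨n, f, lam, hf, h0, hnn, hlt, hsum⟩
    have ha : C.SpanRep f lam a := ⟨fun i => ⟨hnn i, by
      by_cases hi : i = 0
      · rw [hi, h0]
      · exact (hlt i hi).le⟩, hsum⟩
    obtain ⟨ρ, ⟨hρ, hρ0⟩, huniq⟩ := hSp.1 (f 0) (hf.2.1 0)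
    refine ⟨ρ, ⟨hρ, hρ.eq_one_of_coeff_eq_one ha h0 hρ0⟩, fun ω ⟨hω, hωa⟩ =>
      huniq ω ⟨hω, ?_⟩⟩
    rw [← hω.sum_context hf, Finset.sum_eq_single 0
      (fun i _ hi => hω.map_eq_zero_of_lt_one hf ha hωa (hlt i hi)) (by simp)]
end
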